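/- Every minimally unsatisfiable 2-clause-set contains at most two unit-clauses. Moreover, in every minimally unsatisfiable 2-clause-set F with δ(F) ≥ 2, every literal occurs in at most two clauses of F (equivalently, every literal has literal-degree at most 2). -/

import Mathlib

/-- A literal: a variable (a natural number) together with a polarity. -/
abbrev Lit : Type := ℕ × Bool

/-- Complementation of literals: a fixed-point-free involution. -/
def Lit.compl (x : Lit) : Lit := (x.1, !x.2)

/-- The set of variables occurring in a clause-set. -/
def varsOf (F : Finset (Finset Lit)) : Finset ℕ := F.biUnion (fun C => C.image Prod.fst)

/-- The literals over the variables of `F` (both polarities). -/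
def litsOf (F : Finset (Finset Lit)) : Finset Lit := varsOf F ×ˢ (Finset.univ : Finset Bool)

/-- A clause is clash-free. -/
def IsClause (C : Finset Lit) : Prop := ∀ x ∈ C, Lit.compl x ∉ C

/-- A clause-set consists of clauses. -/
def IsClauseSet (F : Finset (Finset Lit)) : Prop := ∀ C ∈ F, IsClause C

/-- The truth value of a literal under a total assignment. -/
def LitVal (φ : ℕ → Bool) (x : Lit) : Bool := if x.2 then φ x.1 else !(φ x.1)

/-- Satisfiability of a clause-set. -/
def Sat (F : Finset (Finset Lit)) : Prop := ∃ φ : ℕ → Bool, ∀ C ∈ F, ∃ x ∈ C, LitVal φ x = true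

/-- Minimal unsatisfiability. -/
def MU (F : Finset (Finset Lit)) : Prop := IsClauseSet F ∧ ¬ Sat F ∧ ∀ G ⊂ F, Sat G

/-- Minimally unsatisfiable 2-clause-set. -/
def MU2 (F : Finset (Finset Lit)) : Prop := MU F ∧ ∀ C ∈ F, C.card ≤ 2

/-- The deficiency δ(F) = c(F) - n(F). -/
def deficiency (F : Finset (Finset Lit)) : ℤ := (F.card : ℤ) - ((varsOf F).card : ℤ)

/-- Literal-degree: number of clauses containing the literal. -/
def ldeg (F : Finset (Finset Lit)) (x : Lit) : ℕ := (F.filter (fun C => x ∈ C)).card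

/-- Variable-degree. -/
def vdeg (F : Finset (Finset Lit)) (v : ℕ) : ℕ := ldeg F (v, true) + ldeg F (v, false)

/-- Isomorphism of clause-sets: a bijection between the literals over the variables,
commuting with complementation, mapping one clause-set onto the other. -/
def CNFIso (F F' : Finset (Finset Lit)) (f : Lit → Lit) : Prop :=
  Set.BijOn f ↑(litsOf F) ↑(litsOf F') ∧
  (∀ x ∈ litsOf F, f (Lit.compl x) = Lit.compl (f x)) ∧
  F.image (fun C => C.image f) = F'

/-- A digraph: a finite vertex set and a finite set of arcs. -/
structure FinDigraph (α : Type) where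
  V : Finset α
  E : Finset (α × α)

/-- Well-formedness of a digraph: arcs join distinct vertices. -/
def FinDigraph.WellFormed {α : Type} (G : FinDigraph α) : Prop :=
  ∀ p ∈ G.E, p.1 ∈ G.V ∧ p.2 ∈ G.V ∧ p.1 ≠ p.2

/-- `f` is an isomorphism of digraphs from `G` to `G'`. -/
def DigraphIso {α β : Type} [DecidableEq β] (G : FinDigraph α) (G' : FinDigraph β) (f : α → β) : Prop :=
  Set.BijOn f ↑G.V ↑G'.V ∧ G.E.image (fun p => (f p.1, f p.2)) = G'.E

/-- The implication digraph of a 2-clause-set (without the empty clause):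
vertices are the literals over the variables of `F`, and there is an arc `(a,b)` iff
`{compl a} ∪ {b}` is a clause of `F` (this yields `(x̄,y),(ȳ,x)` for a clause `{x,y}`
and `(x̄,x)` for a unit-clause `{x}`). -/
def idg (F : Finset (Finset Lit)) : FinDigraph Lit :=
  ⟨litsOf F, (litsOf F ×ˢ litsOf F).filter (fun p => insert (Lit.compl p.1) {p.2} ∈ F)⟩

def FinDigraph.inDeg {α : Type} [DecidableEq α] (G : FinDigraph α) (v : α) : ℕ :=
  (G.E.filter (fun p => p.2 = v)).card

def FinDigraph.outDeg {α : Type} [DecidableEq α] (G : FinDigraph α) (v : α) : ℕ :=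
  (G.E.filter (fun p => p.1 = v)).card

/-- The standard double `m`-cycle. -/
def stdDoubleCycle (m : ℕ) : FinDigraph ℕ :=
  ⟨Finset.range m, (Finset.range m).biUnion (fun i => {(i, (i+1) % m), ((i+1) % m, i)})⟩

/-- A double `m`-cycle (`m ≥ 3`). -/
def IsDoubleCycle {α : Type} [DecidableEq α] (m : ℕ) (G : FinDigraph α) : Prop :=
  3 ≤ m ∧ ∃ f : ℕ → α, DigraphIso (stdDoubleCycle m) G f

/-- Splitting a vertex `x` into `u`, `v` with a new arc `(u,v)`:
arcs into `x` now go into `u`, arcs out of `x` now leave `v`. -/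
def SplitVertex {α : Type} [DecidableEq α] (G G' : FinDigraph α) : Prop :=
  ∃ x u v, x ∈ G.V ∧ u ∉ G.V ∧ v ∉ G.V ∧ u ≠ v ∧
    G'.V = insert u (insert v (G.V.erase x)) ∧
    G'.E = insert (u, v)
      ((G.E.filter (fun p => p.1 ≠ x ∧ p.2 ≠ x)) ∪
       ((G.E.filter (fun p => p.2 = x)).image (fun p => (p.1, u))) ∪
       ((G.E.filter (fun p => p.1 = x)).image (fun p => (v, p.2))))

/-- Splitting an arc `(x,y)` by a new (linear) vertex `v`. -/
def SplitArc {α : Type} [DecidableEq α] (G G' : FinDigraph α) : Prop :=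
  ∃ x y v, (x, y) ∈ G.E ∧ v ∉ G.V ∧
    G'.V = insert v G.V ∧
    G'.E = insert (x, v) (insert (v, y) (G.E.erase (x, y)))

/-- An `m`-weak-double-cycle: obtained from a double `m`-cycle by a finite sequence
of vertex splittings and arc splittings. -/
def IsWDC {α : Type} [DecidableEq α] (m : ℕ) (G : FinDigraph α) : Prop :=
  ∃ G₀ : FinDigraph α, IsDoubleCycle m G₀ ∧
    Relation.ReflTransGen (fun A B => SplitVertex A B ∨ SplitArc A B) G₀ G

/-- A digraph is nonlinear if no vertex has in-degree 1 and out-degree 1. -/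
def FinDigraph.Nonlinear {α : Type} [DecidableEq α] (G : FinDigraph α) : Prop :=
  ∀ v ∈ G.V, ¬ (G.inDeg v = 1 ∧ G.outDeg v = 1)

/-- Strong connectivity. -/
def StronglyConnected {α : Type} (G : FinDigraph α) : Prop :=
  ∀ a ∈ G.V, ∀ b ∈ G.V, Relation.ReflTransGen (fun x y => (x, y) ∈ G.E) a b

/-- A cycle digraph: strongly connected, at least 2 vertices, all vertices linear. -/
def IsCycleDigraph {α : Type} [DecidableEq α] (G : FinDigraph α) : Prop :=
  G.WellFormed ∧ 2 ≤ G.V.card ∧ StronglyConnected G ∧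
    ∀ v ∈ G.V, G.inDeg v = 1 ∧ G.outDeg v = 1

/-- A skew-symmetry of a digraph, as a permutation of its vertex set:
a fixed-point-free involution reversing arcs. -/
def IsSkewSym {α : Type} (G : FinDigraph α) (σ : Equiv.Perm {x // x ∈ G.V}) : Prop :=
  (∀ v, σ (σ v) = v) ∧ (∀ v, σ v ≠ v) ∧
  ∀ a b : {x // x ∈ G.V}, ((a : α), (b : α)) ∈ G.E → (((σ b : α)), ((σ a : α))) ∈ G.E

/-- A skew-symmetry has a unit if some vertex is joined by an arc to its image. -/
def HasUnit {α : Type} (G : FinDigraph α) (σ : Equiv.Perm {x // x ∈ G.V}) : Prop :=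
  ∃ v : {x // x ∈ G.V}, ((v : α), ((σ v : α))) ∈ G.E

/-- The literals over the variables of `F` are closed under complementation. -/
lemma compl_mem {F : Finset (Finset Lit)} {x : Lit} (h : x ∈ litsOf F) :
    Lit.compl x ∈ litsOf F := by
  simp only [litsOf, Lit.compl, Finset.mem_product] at h ⊢
  exact ⟨h.1, Finset.mem_univ _⟩

/-- Clause-set isomorphism, as an equivalence between the literals over the variables. -/
def CNFIsoE (F F' : Finset (Finset Lit))
    (e : {x // x ∈ litsOf F} ≃ {x // x ∈ litsOf F'}) : Prop :=
  (∀ x : {x // x ∈ litsOf F}, (e ⟨Lit.compl x.1, compl_mem x.2⟩ : Lit) = Lit.compl (e x : Lit)) ∧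
  F.image (fun C => C.image (fun y =>
      if h : y ∈ litsOf F then ((e ⟨y, h⟩ : {x // x ∈ litsOf F'}) : Lit) else y)) = F'

/-- An automorphism of a digraph, as a permutation of its vertex set preserving arcs. -/
def FinDigraphAut {α : Type} (G : FinDigraph α) (π : Equiv.Perm {x // x ∈ G.V}) : Prop :=
  ∀ a b : {x // x ∈ G.V}, ((a : α), (b : α)) ∈ G.E ↔ ((π a : α), (π b : α)) ∈ G.E

/-- Multiplicity of the edge between `u` and `v` in the underlying multigraph of a digraph. -/
def mult {α : Type} [DecidableEq α] (G : FinDigraph α) (u v : α) : ℕ :=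
  (if (u, v) ∈ G.E then 1 else 0) + (if (v, u) ∈ G.E then 1 else 0)

/-- `f` is an isomorphism between the underlying multigraphs of two digraphs. -/
def MultigraphIso {α β : Type} [DecidableEq α] [DecidableEq β]
    (G : FinDigraph α) (G' : FinDigraph β) (f : α → β) : Prop :=
  Set.BijOn f ↑G.V ↑G'.V ∧ ∀ u ∈ G.V, ∀ v ∈ G.V, mult G u v = mult G' (f u) (f v)

/-- `f` is an isomorphism between the underlying graphs of two digraphs. -/
def GraphIso {α β : Type} (G : FinDigraph α) (G' : FinDigraph β) (f : α → β) : Prop :=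
  Set.BijOn f ↑G.V ↑G'.V ∧ ∀ u ∈ G.V, ∀ v ∈ G.V,
    (((u, v) ∈ G.E ∨ (v, u) ∈ G.E) ↔ ((f u, f v) ∈ G'.E ∨ (f v, f u) ∈ G'.E))

/-- The transpose of a digraph: all arcs reversed. -/
def FinDigraph.transpose {α : Type} [DecidableEq α] (G : FinDigraph α) : FinDigraph α :=
  ⟨G.V, G.E.image (fun p => (p.2, p.1))⟩

/-- DP-reduction on variable `v`: replace all clauses containing `v` or `v̄` by all
their non-tautological resolvents on `v`. -/
def DP (v : ℕ) (F : Finset (Finset Lit)) : Finset (Finset Lit) :=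
  (F.filter (fun C => (v, true) ∉ C ∧ (v, false) ∉ C)) ∪
  ((((F.filter (fun C => (v, true) ∈ C)) ×ˢ (F.filter (fun C => (v, false) ∈ C))).image
      (fun p => (p.1.erase (v, true)) ∪ (p.2.erase (v, false)))).filter
    (fun C => ∀ x ∈ C, Lit.compl x ∉ C))

/-- A variable is singular if one of its literals has literal-degree 1. -/
def Singular (F : Finset (Finset Lit)) (v : ℕ) : Prop :=
  ldeg F (v, true) = 1 ∨ ldeg F (v, false) = 1

/-- The "middle part" `M_n = {{v̄_1,v_2},…,{v̄_{n−1},v_n}}`, with variables `1,…,n`. -/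
def Mn (n : ℕ) : Finset (Finset Lit) :=
  (Finset.Icc 1 (n - 1)).image (fun i => ({(i, false), (i + 1, true)} : Finset Lit))

def famU2 (n : ℕ) : Finset (Finset Lit) :=
  Mn n ∪ {({((1 : ℕ), true)} : Finset Lit), ({((n : ℕ), false)} : Finset Lit)}

def famU1 (n i : ℕ) : Finset (Finset Lit) :=
  Mn n ∪ {({((1 : ℕ), true)} : Finset Lit), ({((n : ℕ), false), ((i : ℕ), false)} : Finset Lit)}

def famU0s (n i : ℕ) : Finset (Finset Lit) :=
  Mn n ∪ {({((1 : ℕ), true), ((i : ℕ), true)} : Finset Lit),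
          ({((n : ℕ), false), ((i : ℕ), false)} : Finset Lit)}

def famU0 (n x y : ℕ) : Finset (Finset Lit) :=
  Mn n ∪ {({((1 : ℕ), true), ((x : ℕ), true)} : Finset Lit),
          ({((n : ℕ), false), ((y : ℕ), false)} : Finset Lit)}

/-- Membership in one of the four families (with the stated parameter ranges). -/
def InFam (G : Finset (Finset Lit)) : Prop :=
  (∃ n, 1 ≤ n ∧ G = famU2 n) ∨
  (∃ n i, 2 ≤ n ∧ 1 ≤ i ∧ i ≤ n - 1 ∧ G = famU1 n i) ∨
  (∃ n i, 3 ≤ n ∧ 2 ≤ i ∧ 2 * i ≤ n + 1 ∧ G = famU0s n i) ∨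
  (∃ n x y, 4 ≤ n ∧ 2 ≤ x ∧ x < y ∧ y ≤ n - 1 ∧ x + y ≤ n + 1 ∧ G = famU0 n x y)

/-- The number of unit-clauses of `F`. -/
def unitCount (F : Finset (Finset Lit)) : ℕ := (F.filter (fun C => C.card = 1)).card

/-- MU 2-clause-sets of deficiency `k` with exactly `n` variables. -/
def MU2dn (k : ℤ) (n : ℕ) : Type :=
  {F : Finset (Finset Lit) // MU2 F ∧ deficiency F = k ∧ (varsOf F).card = n}

/-- Isomorphism relation on `MU2dn k n`. -/
def isoRel {k : ℤ} {n : ℕ} (F F' : MU2dn k n) : Prop := ∃ f, CNFIso F.1 F'.1 f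

/-- The number of isomorphism classes of MU 2-clause-sets of deficiency `k`
with exactly `n` variables. -/
noncomputable def numClasses (k : ℤ) (n : ℕ) : ℕ := Nat.card (Quot (@isoRel k n))

/-- Equivalence of binary bracelets of length `m`: rotations and reflections of the
cyclic index set. -/
def BraceletRel (m : ℕ) (b b' : ZMod m → Bool) : Prop :=
  ∃ (r : ZMod m) (s : Bool), ∀ i, b' i = b (if s then r - i else i + r)

/-- Digraph-isomorphism relation on nonlinear `m`-WDCs. -/
def NonlinWDCRel (m : ℕ) (G G' : {G : FinDigraph ℕ // IsWDC m G ∧ G.Nonlinear}) : Prop :=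
  ∃ f : ℕ → ℕ, DigraphIso G.1 G'.1 f

/-- `H` is a subdigraph of `G`. -/
def Subdigraph {α : Type} (H G : FinDigraph α) : Prop := H.V ⊆ G.V ∧ H.E ⊆ G.E

/-- The pointwise majority of three assignments. -/
def majority (α β γ : ℕ → Bool) (v : ℕ) : Bool :=
  (α v && β v) || (α v && γ v) || (β v && γ v)

lemma litVal_majority (α β γ : ℕ → Bool) (x : Lit) :
    LitVal (majority α β γ) x =
      ((LitVal α x && LitVal β x) || (LitVal α x && LitVal γ x) ||
        (LitVal β x && LitVal γ x)) := by
  unfold LitVal majority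
  cases x.2 <;> cases α x.1 <;> cases β x.1 <;> cases γ x.1 <;> rfl

/-- The models of a clause with at most two literals are closed under majority. -/
lemma exists_litVal_majority {D : Finset Lit} (hD : D.card ≤ 2) {α β γ : ℕ → Bool}
    (hα : ∃ x ∈ D, LitVal α x = true) (hβ : ∃ x ∈ D, LitVal β x = true)
    (hγ : ∃ x ∈ D, LitVal γ x = true) :
    ∃ x ∈ D, LitVal (majority α β γ) x = true := by
  obtain ⟨a, ha, hαa⟩ := hα
  obtain ⟨b, hb, hβb⟩ := hβ
  obtain ⟨c, hc, hγc⟩ := hγ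
  have hpigeon : a = b ∨ a = c ∨ b = c := by
    by_contra! h
    have := Finset.two_lt_card.mpr ⟨a, ha, b, hb, c, hc, h.1, h.2.1, h.2.2⟩
    omega
  rcases hpigeon with rfl | rfl | rfl
  · exact ⟨a, ha, by simp [litVal_majority, *]⟩
  · exact ⟨a, ha, by simp [litVal_majority, *]⟩
  · exact ⟨b, hb, by simp [litVal_majority, *]⟩

/-- Removing a clause from a minimally unsatisfiable clause-set leaves a model of the
remaining clauses, which must falsify the removed clause. -/
lemma MU.exists_critical {F : Finset (Finset Lit)} (hF : MU F) {C : Finset Lit} (hC : C ∈ F) :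
    ∃ φ : ℕ → Bool, (∀ D ∈ F, D ≠ C → ∃ x ∈ D, LitVal φ x = true) ∧
      ∀ x ∈ C, LitVal φ x ≠ true := by
  obtain ⟨φ, hφ⟩ := hF.2.2 _ (Finset.erase_ssubset hC)
  have hrest : ∀ D ∈ F, D ≠ C → ∃ x ∈ D, LitVal φ x = true := fun D hD hne =>
    hφ D (Finset.mem_erase.mpr ⟨hne, hD⟩)
  refine ⟨φ, hrest, fun x hx hval => hF.2.1 ⟨φ, fun D hD => ?_⟩⟩
  by_cases h : D = C
  · exact ⟨x, h ▸ hx, hval⟩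
  · exact hrest D hD h

/-- If two assignments satisfy a clause at literals outside `S`, and there is at most one such
literal, then both satisfy the same literal. -/
lemma exists_common_litVal {C S : Finset Lit} (hcard : (C \ S).card ≤ 1) {α β : ℕ → Bool}
    (hα : ∃ x ∈ C, LitVal α x = true) (hβ : ∃ x ∈ C, LitVal β x = true)
    (hαS : ∀ x ∈ S, LitVal α x ≠ true) (hβS : ∀ x ∈ S, LitVal β x ≠ true) :
    ∃ x ∈ C, LitVal α x = true ∧ LitVal β x = true := by
  obtain ⟨a, ha, hαa⟩ := hα
  obtain ⟨b, hb, hβb⟩ := hβ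
  have hab : a = b := Finset.card_le_one.mp hcard
    a (Finset.mem_sdiff.mpr ⟨ha, fun h => hαS a h hαa⟩)
    b (Finset.mem_sdiff.mpr ⟨hb, fun h => hβS b h hβb⟩)
  exact ⟨a, ha, hαa, hab ▸ hβb⟩

/-- In a minimally unsatisfiable 2-clause-set, at most two clauses are extensions of a common
set of literals by at most one literal. -/
lemma MU2.card_filter_extension_le_two {F : Finset (Finset Lit)} (hF : MU2 F) (S : Finset Lit) :
    (F.filter (fun C => S ⊆ C ∧ (C \ S).card ≤ 1)).card ≤ 2 := by
  by_contra! h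
  obtain ⟨A, hA, B, hB, C, hC, hAB, hAC, hBC⟩ := Finset.two_lt_card.mp h
  obtain ⟨hAF, hSA, hA1⟩ := Finset.mem_filter.mp hA
  obtain ⟨hBF, hSB, hB1⟩ := Finset.mem_filter.mp hB
  obtain ⟨hCF, hSC, hC1⟩ := Finset.mem_filter.mp hC
  obtain ⟨α, hα, hαA⟩ := hF.1.exists_critical hAF
  obtain ⟨β, hβ, hβB⟩ := hF.1.exists_critical hBF
  obtain ⟨γ, hγ, hγC⟩ := hF.1.exists_critical hCF
  have hαS : ∀ x ∈ S, LitVal α x ≠ true := fun x hx => hαA x (hSA hx)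
  have hβS : ∀ x ∈ S, LitVal β x ≠ true := fun x hx => hβB x (hSB hx)
  have hγS : ∀ x ∈ S, LitVal γ x ≠ true := fun x hx => hγC x (hSC hx)
  refine hF.1.2.1 ⟨majority α β γ, fun D hD => ?_⟩
  by_cases hDA : D = A
  · subst hDA
    obtain ⟨x, hx, h1, h2⟩ :=
      exists_common_litVal hA1 (hβ D hD hAB) (hγ D hD hAC) hβS hγS
    exact ⟨x, hx, by simp [litVal_majority, h1, h2]⟩
  by_cases hDB : D = B
  · subst hDB
    obtain ⟨x, hx, h1, h2⟩ :=
      exists_common_litVal hB1 (hα D hD hAB.symm) (hγ D hD hBC) hαS hγS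
    exact ⟨x, hx, by simp [litVal_majority, h1, h2]⟩
  by_cases hDC : D = C
  · subst hDC
    obtain ⟨x, hx, h1, h2⟩ :=
      exists_common_litVal hC1 (hα D hD hAC.symm) (hβ D hD hBC.symm) hαS hβS
    exact ⟨x, hx, by simp [litVal_majority, h1, h2]⟩
  exact exists_litVal_majority (hF.2 D hD) (hα D hD hDA) (hβ D hD hDB) (hγ D hD hDC)

lemma MU2.unitCount_le_two {F : Finset (Finset Lit)} (hF : MU2 F) : unitCount F ≤ 2 := by
  refine (Finset.card_le_card ?_).trans (hF.card_filter_extension_le_two ∅)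
  intro C hC
  obtain ⟨hCF, hC1⟩ := Finset.mem_filter.mp hC
  exact Finset.mem_filter.mpr ⟨hCF, by simp, by simp [hC1]⟩

lemma MU2.ldeg_le_two {F : Finset (Finset Lit)} (hF : MU2 F) (x : Lit) : ldeg F x ≤ 2 := by
  refine (Finset.card_le_card ?_).trans (hF.card_filter_extension_le_two {x})
  intro C hC
  obtain ⟨hCF, hxC⟩ := Finset.mem_filter.mp hC
  have hsub : {x} ⊆ C := Finset.singleton_subset_iff.mpr hxC
  refine Finset.mem_filter.mpr ⟨hCF, hsub, ?_⟩
  rw [Finset.card_sdiff_of_subset hsub, Finset.card_singleton]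
  have := hF.2 C hCF
  omega

theorem stmt17 :
    (∀ F : Finset (Finset Lit), MU2 F → unitCount F ≤ 2) ∧
    (∀ F : Finset (Finset Lit), MU2 F → (2 : ℤ) ≤ deficiency F →
      ∀ x : Lit, ldeg F x ≤ 2) :=
  ⟨fun _ hF => hF.unitCount_le_two, fun _ hF _ x => hF.ldeg_le_two x⟩
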